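/- Let F = {f_1,…,f_N} be a post-critically finite IFS of bi-Lipschitz contractions on a complete metric space (X,d) with attractor K, satisfying the single intersection condition. Let x = (x_k), y = (y_k) ∈ Σ_K with x ≠ y, let ℓ = |x∧y| be the length of their maximal common prefix and I = x_1⋯x_ℓ. Suppose f_{I x_{ℓ+1}}(K) ∩ f_{I y_{ℓ+1}}(K) = {a} with a = π_K(x), and let n be the least integer with a ∉ f_{y_1⋯y_n}(K). Then x_k ∈ ∂Σ_K for every k ≥ ℓ+2, and y_k ∈ ∂Σ_K for every k with ℓ+2 ≤ k ≤ n−1. -/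

import Mathlib

open Set Metric
open scoped ENNReal

/-- `wordMap f [i₁,…,i_k] = f i₁ ∘ ⋯ ∘ f i_k`. -/
def wordMap {X : Type*} {ι : Type*} (f : ι → X → X) : List ι → X → X
  | [] => id
  | i :: I => f i ∘ wordMap f I

/-- The prefix word `x₁ ⋯ x_n` of an infinite word `x`. -/
def pre {ι : Type*} (x : ℕ → ι) (n : ℕ) : List ι := List.ofFn (fun j : Fin n => x j)

/-- `K` is the attractor of the IFS `f`: the (unique) nonempty compact set with
`K = ⋃ i, f i '' K`. -/
def IsAttractor {X : Type*} [MetricSpace X] {ι : Type*} (f : ι → X → X) (K : Set X) : Prop :=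
  K.Nonempty ∧ IsCompact K ∧ K = ⋃ i, f i '' K

/-- `g` is a bi-Lipschitz contraction. -/
def IsBiLipContraction {X : Type*} [MetricSpace X] (g : X → X) : Prop :=
  ∃ A B : ℝ, 0 < A ∧ B < 1 ∧ ∀ x y : X,
    A * dist x y ≤ dist (g x) (g y) ∧ dist (g x) (g y) ≤ B * dist x y

/-- `g` is a similitude of ratio `r`. -/
def IsSimilitude {X : Type*} [MetricSpace X] (g : X → X) (r : ℝ) : Prop :=
  ∀ x y : X, dist (g x) (g y) = r * dist x y

/-- The critical set `C_F = ⋃_{i ≠ j} f_i(K) ∩ f_j(K)`. -/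
def criticalSet {X : Type*} {ι : Type*} (f : ι → X → X) (K : Set X) : Set X :=
  ⋃ (i : ι) (j : ι) (_ : i ≠ j), (f i '' K) ∩ (f j '' K)

/-- The post-critical set `P_F = ⋃_{ω ∈ Σ^*} f_ω⁻¹(C_F) ∩ K`. -/
def postCriticalSet {X : Type*} {ι : Type*} (f : ι → X → X) (K : Set X) : Set X :=
  {p | p ∈ K ∧ ∃ I : List ι, I ≠ [] ∧ wordMap f I p ∈ criticalSet f K}

/-- `π` is the coding map of `(f, K)`: `{π x} = ⋂_k f_{x₁⋯x_k}(K)`. -/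
def IsCodingMap {X : Type*} {ι : Type*} (f : ι → X → X) (K : Set X)
    (π : (ℕ → ι) → X) : Prop :=
  ∀ x : ℕ → ι, (⋂ k : ℕ, wordMap f (pre x (k + 1)) '' K) = {π x}

/-- Single intersection condition: `f_i(K) ∩ f_j(K)` contains at most one point for `i ≠ j`. -/
def SIC {X : Type*} {ι : Type*} (f : ι → X → X) (K : Set X) : Prop :=
  ∀ i j : ι, i ≠ j → ((f i '' K) ∩ (f j '' K)).Subsingleton

/-- Angle separation condition with respect to a distance function `D`. -/
def ASCwrt {X : Type*} {ι : Type*} (f : ι → X → X) (K : Set X) (D : X → X → ℝ) : Prop :=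
  ∃ c : ℝ, 0 < c ∧ ∀ i j : ι, i ≠ j → ∀ z : X, (f i '' K) ∩ (f j '' K) = {z} →
    ∀ x ∈ f i '' K, ∀ y ∈ f j '' K, c * max (D x z) (D y z) ≤ D x y

/-- Angle separation condition. -/
def ASC {X : Type*} [MetricSpace X] {ι : Type*} (f : ι → X → X) (K : Set X) : Prop :=
  ASCwrt f K dist

/-- Lexicographic order on infinite words. -/
def lexLe {ι : Type*} [LinearOrder ι] (x y : ℕ → ι) : Prop :=
  x = y ∨ ∃ n : ℕ, (∀ k < n, x k = y k) ∧ x n < y n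

/-- `Σ_K`: the set of lowest codings, i.e. of words that are lexicographically least
among all words with the same image under the coding map `π`. -/
def lowestCodings {X : Type*} {ι : Type*} [LinearOrder ι] (π : (ℕ → ι) → X) :
    Set (ℕ → ι) :=
  {x | ∀ y : ℕ → ι, π y = π x → lexLe x y}

/-- `∂Σ_K`: the set of first letters of codings of post-critical points. -/
def bdryLetters {X : Type*} {ι : Type*} (f : ι → X → X) (K : Set X)
    (π : (ℕ → ι) → X) : Set ι :=
  {i | ∃ x : ℕ → ι, π x ∈ postCriticalSet f K ∧ x 0 = i}

/-- The contraction ratio `r_I = r_{i₁} ⋯ r_{i_k}` of a word. -/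
def rword {ι : Type*} (r : ι → ℝ) (I : List ι) : ℝ := (I.map r).prod

theorem IsBiLipContraction.injective {X : Type*} [MetricSpace X] {g : X → X}
    (hg : IsBiLipContraction g) : Function.Injective g := by
  obtain ⟨A, B, hA, -, h⟩ := hg
  intro x y hxy
  have h₁ := (h x y).1
  rw [hxy, dist_self] at h₁
  exact dist_le_zero.1 (by nlinarith)

theorem wordMap_append {X : Type*} {ι : Type*} (f : ι → X → X) (I J : List ι) (p : X) :
    wordMap f (I ++ J) p = wordMap f I (wordMap f J p) := by
  induction I with
  | nil => rfl
  | cons i I ih => exact congrArg (f i) ih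

theorem wordMap_injective {X : Type*} {ι : Type*} {f : ι → X → X}
    (hf : ∀ i, Function.Injective (f i)) (I : List ι) : Function.Injective (wordMap f I) := by
  induction I with
  | nil => exact Function.injective_id
  | cons i I ih => exact (hf i).comp ih

theorem wordMap_mem {X : Type*} {ι : Type*} {f : ι → X → X} {K : Set X}
    (hf : ∀ i, ∀ p ∈ K, f i p ∈ K) (I : List ι) {p : X} (hp : p ∈ K) : wordMap f I p ∈ K := by
  induction I with
  | nil => exact hp
  | cons i I ih => exact hf i _ ih

theorem pre_succ {ι : Type*} (x : ℕ → ι) (n : ℕ) :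
    pre x (n + 1) = x 0 :: pre (fun k => x (k + 1)) n := by
  simp [pre, List.ofFn_succ]

theorem pre_add {ι : Type*} (x : ℕ → ι) (m n : ℕ) :
    pre x (m + n) = pre x m ++ pre (fun k => x (m + k)) n := by
  induction m generalizing x with
  | zero => simp [pre]
  | succ m ih =>
    rw [Nat.add_right_comm, pre_succ, pre_succ, ih, List.cons_append]
    simp only [Nat.add_right_comm]

theorem pre_congr {ι : Type*} {x y : ℕ → ι} {n : ℕ} (h : ∀ j < n, x j = y j) :
    pre x n = pre y n := by
  unfold pre
  congr 1
  funext j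
  exact h j j.2

theorem IsAttractor.map_mem {X : Type*} [MetricSpace X] {ι : Type*} {f : ι → X → X} {K : Set X}
    (hK : IsAttractor f K) (i : ι) (p : X) (hp : p ∈ K) : f i p ∈ K := by
  rw [hK.2.2]
  exact mem_iUnion.2 ⟨i, mem_image_of_mem _ hp⟩

section CodingMap

variable {X : Type*} {ι : Type*} {f : ι → X → X} {K : Set X} {π : (ℕ → ι) → X}

theorem IsCodingMap.mem_image (hπ : IsCodingMap f K π) (x : ℕ → ι) (k : ℕ) :
    π x ∈ wordMap f (pre x (k + 1)) '' K := by
  have h : π x ∈ ⋂ k : ℕ, wordMap f (pre x (k + 1)) '' K := by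
    rw [hπ x]
    exact mem_singleton _
  exact mem_iInter.1 h k

theorem IsCodingMap.eq_of_forall_mem (hπ : IsCodingMap f K π) {x : ℕ → ι} {p : X}
    (h : ∀ k, p ∈ wordMap f (pre x (k + 1)) '' K) : p = π x := by
  have h₁ : p ∈ ⋂ k : ℕ, wordMap f (pre x (k + 1)) '' K := mem_iInter.2 h
  rwa [hπ x] at h₁

variable [MetricSpace X]

theorem IsCodingMap.mem (hπ : IsCodingMap f K π) (hK : IsAttractor f K) (x : ℕ → ι) :
    π x ∈ K := by
  obtain ⟨q, hq, h⟩ := hπ.mem_image x 0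
  rw [← h]
  exact wordMap_mem hK.map_mem _ hq

theorem IsCodingMap.map_shift (hπ : IsCodingMap f K π) (hK : IsAttractor f K) (x : ℕ → ι) :
    f (x 0) (π fun k => x (k + 1)) = π x := by
  refine hπ.eq_of_forall_mem fun k => ?_
  rw [pre_succ]
  cases k with
  | zero => exact ⟨_, hπ.mem hK _, rfl⟩
  | succ k =>
    obtain ⟨q, hq, h⟩ := hπ.mem_image (fun k => x (k + 1)) k
    exact ⟨q, hq, congrArg (f (x 0)) h⟩

theorem IsCodingMap.wordMap_shift (hπ : IsCodingMap f K π) (hK : IsAttractor f K) (x : ℕ → ι)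
    (m : ℕ) : wordMap f (pre x m) (π fun k => x (m + k)) = π x := by
  induction m generalizing x with
  | zero => simp [pre, wordMap]
  | succ m ih =>
    have h := congrArg (f (x 0)) (ih fun k => x (k + 1))
    rw [hπ.map_shift hK x] at h
    rw [pre_succ]
    simpa only [wordMap, Function.comp_apply, Nat.add_right_comm] using h

theorem IsCodingMap.exists_coding (hπ : IsCodingMap f K π) (hK : IsAttractor f K) {p : X}
    (hp : p ∈ K) : ∃ x, π x = p := by
  have h : ∀ q : K, ∃ i : ι, ∃ r : K, f i r = q := by
    rintro ⟨q, hq⟩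
    have hq' := hq
    rw [hK.2.2] at hq'
    obtain ⟨i, r, hr, e⟩ := mem_iUnion.1 hq'
    exact ⟨i, ⟨r, hr⟩, e⟩
  choose letter next hnext using h
  have key : ∀ (k : ℕ) (q : K),
      (q : X) ∈ wordMap f (pre (fun j => letter (next^[j] q)) k) '' K := by
    intro k
    induction k with
    | zero => exact fun q => ⟨q, q.2, rfl⟩
    | succ k ih =>
      intro q
      obtain ⟨r, hr, e⟩ := ih (next q)
      rw [pre_succ]
      exact ⟨r, hr, (congrArg (f (letter q)) e).trans (hnext q)⟩
  exact ⟨_, (hπ.eq_of_forall_mem fun k => key (k + 1) ⟨p, hp⟩).symm⟩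

theorem IsCodingMap.mem_bdryLetters (hπ : IsCodingMap f K π) (hK : IsAttractor f K) {i : ι}
    {q : X} (hq : q ∈ K) (h : f i q ∈ postCriticalSet f K) : i ∈ bdryLetters f K π := by
  obtain ⟨z, rfl⟩ := hπ.exists_coding hK hq
  refine ⟨fun k => Nat.casesOn k i z, ?_, rfl⟩
  rwa [← hπ.map_shift hK]

end CodingMap

/-- **Corollary.** (Type (iii) separation prefix produces boundary letters.)
With `ℓ = |x ∧ y|`, if `f_{x₁⋯x_{ℓ+1}}(K) ∩ f_{y₁⋯y_{ℓ+1}}(K) = {a}` with `a = π x` and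
`n` is least with `a ∉ f_{y₁⋯y_n}(K)`, then the paper's letters `x_k` for all `k ≥ ℓ+2`
and `y_k` for `ℓ+2 ≤ k ≤ n-1` lie in `∂Σ_K`.
(Sequences here are 0-indexed: the paper's `x_k` is `x (k-1)`.) -/
theorem letters_in_boundary_of_type_three_separation
    {X : Type*} [MetricSpace X] [CompleteSpace X]
    {N : ℕ} (f : Fin N → X → X) (K : Set X) (π : (ℕ → Fin N) → X)
    (hf : ∀ i, IsBiLipContraction (f i))
    (hK : IsAttractor f K) (hπ : IsCodingMap f K π)
    (hpcf : (π ⁻¹' postCriticalSet f K).Finite)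
    (hSIC : SIC f K)
    (x y : ℕ → Fin N) (hx : x ∈ lowestCodings π) (hy : y ∈ lowestCodings π)
    (hxy : x ≠ y)
    (ℓ : ℕ) (hpre : ∀ j < ℓ, x j = y j) (hℓ : x ℓ ≠ y ℓ)
    (a : X)
    (ha : (wordMap f (pre x (ℓ + 1)) '' K) ∩ (wordMap f (pre y (ℓ + 1)) '' K) = {a})
    (hax : a = π x)
    (n : ℕ)
    (hn : IsLeast {t : ℕ | a ∉ wordMap f (pre y t) '' K} n) :
    (∀ j : ℕ, ℓ + 1 ≤ j → x j ∈ bdryLetters f K π) ∧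
    (∀ j : ℕ, ℓ + 1 ≤ j → j + 2 ≤ n → y j ∈ bdryLetters f K π) := by
  have hinj := wordMap_injective fun i => (hf i).injective
  set p := π fun k => x (ℓ + k) with hp
  have hpx : wordMap f (pre x ℓ) p = a := by rw [hax, hp, hπ.wordMap_shift hK]
  have hpy : wordMap f (pre y ℓ) p = a := by rw [← pre_congr hpre, hpx]
  have split : ∀ (z : ℕ → Fin N) (m : ℕ) (q : X), wordMap f (pre z ℓ) p = a →
      wordMap f (pre z (ℓ + m)) q = a → wordMap f (pre (fun k => z (ℓ + k)) m) q = p := by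
    intro z m q hz h
    rw [pre_add, wordMap_append, ← hz] at h
    exact hinj _ h
  have hcrit : p ∈ criticalSet f K := by
    have hmem : a ∈ (wordMap f (pre x (ℓ + 1)) '' K) ∩ (wordMap f (pre y (ℓ + 1)) '' K) := by
      rw [ha]
      exact mem_singleton a
    obtain ⟨⟨q, hq, hqa⟩, ⟨r, hr, hra⟩⟩ := hmem
    exact mem_iUnion.2 ⟨x ℓ, mem_iUnion.2 ⟨y ℓ, mem_iUnion.2
      ⟨hℓ, ⟨q, hq, split x 1 q hpx hqa⟩, ⟨r, hr, split y 1 r hpy hra⟩⟩⟩⟩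
  have bdry : ∀ (z : ℕ → Fin N), wordMap f (pre z ℓ) p = a → ∀ j, ℓ + 1 ≤ j →
      a ∈ wordMap f (pre z (j + 1)) '' K → z j ∈ bdryLetters f K π := by
    rintro z hz j hj ⟨q, hq, hqa⟩
    obtain ⟨m, rfl⟩ : ∃ m, j = ℓ + (m + 1) := ⟨j - ℓ - 1, by omega⟩
    refine hπ.mem_bdryLetters hK hq
      ⟨hK.map_mem _ _ hq, pre (fun k => z (ℓ + k)) (m + 1), by simp [pre_succ], ?_⟩
    rw [pre_add, wordMap_append] at hqa
    rwa [split z (m + 1) (f (z (ℓ + (m + 1))) q) hz hqa]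
  refine ⟨fun j hj => bdry x hpx j hj (hax ▸ hπ.mem_image x j), fun j hj hjn =>
    bdry y hpy j hj ?_⟩
  by_contra h
  have := hn.2 h
  omega
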